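/- arXiv:2401.11477 — 6 statements merged into one kernel-verified Lean document; each statement's English description precedes it below -/
import Mathlib

section
/- Let (x̃,ρ,B̃) be a generalized seed of a generalized cluster algebra of geometric type. If the standard monomials in x_1, x'_1, …, x_n, x'_n are linearly independent over ℤℙ, then the directed graph Γ(x̃,ρ,B̃) contains no oriented 3-cycle; equivalently, there do not exist indices i, j, k ∈ [1,n] with b_{ij} > 0, b_{jk} > 0 and b_{ki} > 0. -/
open Finset

namespace GCA

/-- Ambient field: the field of rational functions `ℚ(x₁,…,x_m)`. -/
abbrev K (m : ℕ) : Type := FractionRing (MvPolynomial (Fin m) ℚ)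

/-- The variables `x₁,…,x_m` inside the ambient field. -/
noncomputable def xv (m : ℕ) (j : Fin m) : K m :=
  algebraMap (MvPolynomial (Fin m) ℚ) (K m) (MvPolynomial.X j)

/-- The coefficient ring `ℤℙ`: the Laurent polynomial ring generated over `ℤ`
by the frozen variables `x_{n+1},…,x_m` and their inverses, as a subalgebra of `K m`. -/
noncomputable def ZP (m n : ℕ) : Subalgebra ℤ (K m) :=
  Algebra.adjoin ℤ {y | ∃ j : Fin m, n ≤ (j : ℕ) ∧ (y = xv m j ∨ y = (xv m j)⁻¹)}

/-- A (generalized) seed datum: the extended cluster, strings, and the exchange matrix. -/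
structure Seed (m n : ℕ) where
  x : Fin m → K m
  ρ : Fin n → ℕ → K m
  B : Matrix (Fin m) (Fin n) ℤ

variable {m n : ℕ}

/-- The exponent `⌊[rβ]₊⌋ + ⌊[−(d−r)β]₊⌋` where `β = b/d`. -/
def mutExp (d : ℕ) (b : ℤ) (r : ℕ) : ℤ :=
  ⌊max ((r : ℚ) * b / d) 0⌋ + ⌊max (-(((d : ℚ) - r) * b / d)) 0⌋

/-- Matrix mutation in direction `i` of an `m × n` exchange matrix. -/
def matMut (hmn : n ≤ m) (i : Fin n) (B : Matrix (Fin m) (Fin n) ℤ) :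
    Matrix (Fin m) (Fin n) ℤ := fun k l =>
  if k = Fin.castLE hmn i ∨ l = i then -B k l
  else B k l + (|B k i| * B (Fin.castLE hmn i) l + B k i * |B (Fin.castLE hmn i) l|) / 2

/-- The exchanged cluster variable `x'_i` of a seed. -/
noncomputable def exchangeVar (hmn : n ≤ m) (d : Fin n → ℕ) (S : Seed m n) (i : Fin n) :
    K m :=
  (S.x (Fin.castLE hmn i))⁻¹ *
    ∑ r ∈ Finset.range (d i + 1),
      S.ρ i r * ∏ k : Fin m, S.x k ^ mutExp (d i) (S.B k i) r

/-- Seed mutation in direction `i`. -/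
noncomputable def Seed.mut (hmn : n ≤ m) (d : Fin n → ℕ) (i : Fin n) (S : Seed m n) :
    Seed m n where
  x := fun j => if j = Fin.castLE hmn i then exchangeVar hmn d S i else S.x j
  ρ := fun j r => if j = i then S.ρ i (d i - r) else S.ρ j r
  B := matMut hmn i S.B

/-- Apply a finite sequence of mutations (left-most applied first). -/
noncomputable def mutSeq (hmn : n ≤ m) (d : Fin n → ℕ) : List (Fin n) → Seed m n → Seed m n
  | [], S => S
  | i :: l, S => mutSeq hmn d l (Seed.mut hmn d i S)

/-- `seedUpTo hmn d S k = μ_k ⋯ μ_2 μ_1 (S)` (paper's direction `t ∈ [1,n]` is Lean's `t-1`). -/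
noncomputable def seedUpTo (hmn : n ≤ m) (d : Fin n → ℕ) (S : Seed m n) : ℕ → Seed m n
  | 0 => S
  | k + 1 => if h : k < n then Seed.mut hmn d ⟨k, h⟩ (seedUpTo hmn d S k) else seedUpTo hmn d S k

/-- The initial seed whose cluster variables are the canonical variables of `ℚ(x₁,…,x_m)`. -/
noncomputable def initSeed (m n : ℕ) (ρ : Fin n → ℕ → K m) (B : Matrix (Fin m) (Fin n) ℤ) :
    Seed m n := ⟨xv m, ρ, B⟩

/-- The principal part of `B` is skew-symmetrizable. -/
def SkewSymmetrizable (hmn : n ≤ m) (B : Matrix (Fin m) (Fin n) ℤ) : Prop :=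
  ∃ D : Fin n → ℤ, (∀ i, 0 < D i) ∧
    ∀ i j : Fin n, D i * B (Fin.castLE hmn i) j = -(D j * B (Fin.castLE hmn j) i)

/-- `p` is a monomial in `ℤ[x_{n+1},…,x_m]`. -/
def IsFrozenMonomial (m n : ℕ) (p : K m) : Prop :=
  ∃ (c : ℤ) (e : Fin m → ℕ), (∀ j : Fin m, (j : ℕ) < n → e j = 0) ∧
    p = (c : K m) * ∏ j : Fin m, xv m j ^ e j

/-- The defining conditions on the datum `(d, ρ, B)` of a generalized seed of geometric type. -/
structure SeedHyps (m n : ℕ) (hmn : n ≤ m) (d : Fin n → ℕ) (ρ : Fin n → ℕ → K m)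
    (B : Matrix (Fin m) (Fin n) ℤ) : Prop where
  d_pos : ∀ i, 0 < d i
  d_dvd : ∀ i j : Fin n, (d i : ℤ) ∣ B (Fin.castLE hmn j) i
  skew : SkewSymmetrizable hmn B
  rho_zero : ∀ i, ρ i 0 = 1
  rho_top : ∀ i, ρ i (d i) = 1
  rho_mon : ∀ i r, r ≤ d i → IsFrozenMonomial m n (ρ i r)

/-- The edge relation of the directed graph `Γ`: an edge from `i` to `j` iff `b_{ij} > 0`. -/
def GammaEdge (hmn : n ≤ m) (B : Matrix (Fin m) (Fin n) ℤ) (i j : Fin n) : Prop :=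
  0 < B (Fin.castLE hmn i) j

/-- The directed graph `Γ` has no oriented cycle. -/
def Acyclic (hmn : n ≤ m) (B : Matrix (Fin m) (Fin n) ℤ) : Prop :=
  ∀ i : Fin n, ¬ Relation.TransGen (GammaEdge hmn B) i i

/-- The ordering normalization: `b_{ij} ≥ 0` whenever `n ≥ i > j ≥ 1`. -/
def Ordered (hmn : n ≤ m) (B : Matrix (Fin m) (Fin n) ℤ) : Prop :=
  ∀ i j : Fin n, j < i → 0 ≤ B (Fin.castLE hmn i) j

/-- Divisibility inside a subset `R` of the ambient field. -/
def DvdIn (R : Set (K m)) (p u : K m) : Prop := ∃ z ∈ R, u = p * z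

/-- `u` and `v` are coprime in `R`: every common divisor in `R` is a unit of `R`. -/
def CoprimeIn (R : Set (K m)) (u v : K m) : Prop :=
  ∀ p ∈ R, DvdIn R p u → DvdIn R p v → ∃ q ∈ R, p * q = 1

/-- The polynomial ring `ℤℙ[x₁,…,x_n]` as a subalgebra of `K m`. -/
noncomputable def polyRing (hmn : n ≤ m) : Subalgebra ℤ (K m) :=
  Algebra.adjoin ℤ
    ({y | ∃ j : Fin m, n ≤ (j : ℕ) ∧ (y = xv m j ∨ y = (xv m j)⁻¹)} ∪
      {y | ∃ j : Fin n, y = xv m (Fin.castLE hmn j)})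

/-- The seed is coprime: the exchange polynomials `x_i x'_i` are pairwise coprime
in `ℤℙ[x₁,…,x_n]`. -/
def CoprimeSeed (hmn : n ≤ m) (d : Fin n → ℕ) (S : Seed m n) : Prop :=
  ∀ i j : Fin n, i ≠ j →
    CoprimeIn (↑(polyRing hmn (m := m)) : Set (K m))
      (S.x (Fin.castLE hmn i) * exchangeVar hmn d S i)
      (S.x (Fin.castLE hmn j) * exchangeVar hmn d S j)

/-- All cluster variables of all seeds mutation-equivalent to `S`. -/
noncomputable def clusterVars (hmn : n ≤ m) (d : Fin n → ℕ) (S : Seed m n) : Set (K m) :=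
  {y | ∃ (L : List (Fin n)) (i : Fin n), y = (mutSeq hmn d L S).x (Fin.castLE hmn i)}

/-- The generalized cluster algebra `𝒜(x̃,ρ,B̃)` as a `ℤℙ`-subalgebra of `ℚ(x₁,…,x_m)`. -/
noncomputable def gca (hmn : n ≤ m) (d : Fin n → ℕ) (S : Seed m n) :
    Subalgebra (↥(ZP m n)) (K m) :=
  Algebra.adjoin (↥(ZP m n)) (clusterVars hmn d S)

/-- The generalized projective cluster variable `x_i^{(n)}`. -/
noncomputable def projVar (hmn : n ≤ m) (d : Fin n → ℕ) (S : Seed m n) (i : Fin n) : K m :=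
  (seedUpTo hmn d S n).x (Fin.castLE hmn i)

/-- The lower bound generalized cluster algebra
`ℒ^{(n)}(Σ) = ℤℙ[x₁, x₁^{(n)}, …, x_n, x_n^{(n)}]`. -/
noncomputable def lowerBound (hmn : n ≤ m) (d : Fin n → ℕ) (S : Seed m n) :
    Subalgebra (↥(ZP m n)) (K m) :=
  Algebra.adjoin (↥(ZP m n))
    ({y | ∃ i : Fin n, y = S.x (Fin.castLE hmn i)} ∪
      {y | ∃ i : Fin n, y = projVar hmn d S i})

/-- Index type for standard monomials: exponent pairs with no product `x_i x'_i`. -/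
def StdIdx (n : ℕ) : Type := {v : Fin n → ℕ × ℕ // ∀ i, (v i).1 = 0 ∨ (v i).2 = 0}

/-- The (projective) standard monomial attached to an exponent vector. -/
noncomputable def stdMon (x x' : Fin n → K m) (v : StdIdx n) : K m :=
  ∏ i : Fin n, x i ^ (v.1 i).1 * x' i ^ (v.1 i).2

/-- Lexicographic order on exponent vectors. -/
def lexLt (a b : Fin n → ℤ) : Prop :=
  ∃ k : Fin n, a k < b k ∧ ∀ j : Fin n, j < k → a j = b j

/-- The Laurent monomial `x^a = x₁^{a₁} ⋯ x_n^{a_n}`. -/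
noncomputable def xpow (hmn : n ≤ m) (a : Fin n → ℤ) : K m :=
  ∏ i : Fin n, xv m (Fin.castLE hmn i) ^ a i

/-- `x^a` is the first Laurent monomial of `Y` (with some nonzero leading
coefficient in `ℤℙ`): `Y = c_a x^a + Σ_v c_v x^v` with all `v ≺ a`. -/
def IsFirstMonomial (hmn : n ≤ m) (Y : K m) (a : Fin n → ℤ) : Prop :=
  ∃ (s : Finset (Fin n → ℤ)) (c : (Fin n → ℤ) → K m),
    (∀ v, c v ∈ ZP m n) ∧ c a ≠ 0 ∧ (∀ v ∈ s, lexLt v a) ∧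
    Y = c a * xpow hmn a + ∑ v ∈ s, c v * xpow hmn v

end GCA

namespace GCA

theorem mutExp_nonneg (d : ℕ) (b : ℤ) (r : ℕ) : 0 ≤ mutExp d b r := by
  unfold mutExp
  exact add_nonneg (Int.floor_nonneg.2 (le_max_right _ _)) (Int.floor_nonneg.2 (le_max_right _ _))

theorem one_le_mutExp_pos (d : ℕ) (b : ℤ) (r : ℕ) (hd : 0 < d) (hdvd : (d : ℤ) ∣ b)
    (hb : 0 < b) (hr : 1 ≤ r) : 1 ≤ mutExp d b r := by
  unfold mutExp
  have h1 : (1 : ℤ) ≤ ⌊max ((r : ℚ) * b / d) 0⌋ := by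
    rw [Int.le_floor]
    refine le_trans ?_ (le_max_left _ _)
    have hdb : (d : ℤ) ≤ b := Int.le_of_dvd hb hdvd
    have hdb' : (d : ℚ) ≤ b := by exact_mod_cast hdb
    have hr' : (1 : ℚ) ≤ r := by exact_mod_cast hr
    have hd' : (0 : ℚ) < d := by exact_mod_cast hd
    rw [le_div_iff₀ hd']
    push_cast
    nlinarith
  have h2 : (0 : ℤ) ≤ ⌊max (-(((d : ℚ) - r) * b / d)) 0⌋ :=
    Int.floor_nonneg.2 (le_max_right _ _)
  linarith

theorem one_le_mutExp_neg (d : ℕ) (b : ℤ) (hd : 0 < d) (hb : b < 0) : 1 ≤ mutExp d b 0 := by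
  unfold mutExp
  have h1 : (0 : ℤ) ≤ ⌊max (((0 : ℕ) : ℚ) * b / d) 0⌋ :=
    Int.floor_nonneg.2 (le_max_right _ _)
  have h2 : (1 : ℤ) ≤ ⌊max (-(((d : ℚ) - (0 : ℕ)) * b / d)) 0⌋ := by
    rw [Int.le_floor]
    refine le_trans ?_ (le_max_left _ _)
    have hb' : (b : ℚ) ≤ -1 := by exact_mod_cast (by omega : b ≤ -1)
    have hd' : (d : ℚ) ≠ 0 := by exact_mod_cast hd.ne'
    have : ((d : ℚ) - (0 : ℕ)) * b / d = b := by
      field_simp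
      simp
    rw [this]
    push_cast
    linarith
  linarith

theorem xv_ne_zero (m : ℕ) (j : Fin m) : xv m j ≠ 0 := by
  unfold xv
  rw [Ne, IsFractionRing.to_map_eq_zero_iff]
  exact MvPolynomial.X_ne_zero j

/-- Polynomials in the mutable variables with coefficients in `ZP`. -/
noncomputable def polyA {m n : ℕ} (hmn : n ≤ m) : Subalgebra (↥(ZP m n)) (K m) :=
  (MvPolynomial.aeval (R := ↥(ZP m n)) (fun i : Fin n => xv m (Fin.castLE hmn i))).range

theorem mem_polyA_of_ZP {m n : ℕ} (hmn : n ≤ m) {c : K m} (hc : c ∈ ZP m n) :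
    c ∈ polyA hmn :=
  (polyA hmn).algebraMap_mem (⟨c, hc⟩ : ↥(ZP m n))

theorem xv_mem_polyA {m n : ℕ} (hmn : n ≤ m) (k : Fin m) : xv m k ∈ polyA hmn := by
  by_cases h : (k : ℕ) < n
  · exact ⟨MvPolynomial.X ⟨k, h⟩, by simp⟩
  · exact mem_polyA_of_ZP hmn (Algebra.subset_adjoin ⟨k, by omega, Or.inl rfl⟩)

theorem monomial_mem_polyA {m n : ℕ} (hmn : n ≤ m) (e : Fin m → ℤ) (he : ∀ k, 0 ≤ e k) :
    ∏ k, xv m k ^ e k ∈ polyA hmn := by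
  refine Subalgebra.prod_mem _ fun k _ => ?_
  obtain ⟨t, ht⟩ := Int.eq_ofNat_of_zero_le (he k)
  rw [ht]
  simpa using Subalgebra.pow_mem _ (xv_mem_polyA hmn k) t

theorem monomial_div {m n : ℕ} (hmn : n ≤ m) (e : Fin m → ℤ) (he : ∀ k, 0 ≤ e k)
    (p : Fin m) (hp : 1 ≤ e p) :
    ∃ F ∈ polyA hmn, ∏ k, xv m k ^ e k = xv m p * F := by
  refine ⟨∏ k, xv m k ^ (e k - if k = p then 1 else 0), monomial_mem_polyA hmn _ ?_, ?_⟩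
  · intro k
    have := he k
    split_ifs with h
    · subst h; omega
    · omega
  · have : xv m p = ∏ k, xv m k ^ (if k = p then (1 : ℤ) else 0) := by
      rw [Finset.prod_eq_single p]
      · simp
      · intro b _ hb; simp [hb]
      · simp
    conv_rhs => rw [this, ← Finset.prod_mul_distrib]
    refine Finset.prod_congr rfl fun k _ => ?_
    rw [← zpow_add₀ (xv_ne_zero m k)]
    congr 1
    ring

theorem rho_mem {m n : ℕ} (hmn : n ≤ m) {p : K m} (hp : IsFrozenMonomial m n p) :
    p ∈ polyA hmn := by
  obtain ⟨c, e, -, rfl⟩ := hp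
  refine Subalgebra.mul_mem _ (by simp) ?_
  exact Subalgebra.prod_mem _ fun k _ => Subalgebra.pow_mem _ (xv_mem_polyA hmn k) _

theorem exchange_split {m n : ℕ} (hmn : n ≤ m) (d : Fin n → ℕ) (ρ : Fin n → ℕ → K m)
    (B : Matrix (Fin m) (Fin n) ℤ) (hseed : SeedHyps m n hmn d ρ B) (i p q : Fin n)
    (hp : 0 < B (Fin.castLE hmn p) i) (hq : B (Fin.castLE hmn q) i < 0) :
    ∃ F ∈ polyA hmn, ∃ G ∈ polyA hmn,
      xv m (Fin.castLE hmn i) * exchangeVar hmn d (initSeed m n ρ B) i =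
        xv m (Fin.castLE hmn p) * F + xv m (Fin.castLE hmn q) * G := by
  have hx : xv m (Fin.castLE hmn i) * exchangeVar hmn d (initSeed m n ρ B) i =
      ∑ r ∈ Finset.range (d i + 1), ρ i r * ∏ k : Fin m, xv m k ^ mutExp (d i) (B k i) r := by
    unfold exchangeVar initSeed
    exact mul_inv_cancel_left₀ (xv_ne_zero m _) _
  rw [hx]
  refine Finset.sum_induction _ (fun z => ∃ F ∈ polyA hmn, ∃ G ∈ polyA hmn,
    z = xv m (Fin.castLE hmn p) * F + xv m (Fin.castLE hmn q) * G) ?_ ?_ ?_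
  · rintro a b ⟨F, hF, G, hG, rfl⟩ ⟨F', hF', G', hG', rfl⟩
    exact ⟨F + F', add_mem hF hF', G + G', add_mem hG hG', by ring⟩
  · exact ⟨0, zero_mem _, 0, zero_mem _, by simp⟩
  · intro r hr
    have hρ := rho_mem hmn (hseed.rho_mon i r (by simpa [Nat.lt_succ_iff] using hr))
    have hnn : ∀ k, 0 ≤ mutExp (d i) (B k i) r := fun k => mutExp_nonneg _ _ _
    rcases Nat.eq_zero_or_pos r with h0 | h0
    · subst h0
      obtain ⟨F, hF, h⟩ := monomial_div hmn (fun k => mutExp (d i) (B k i) 0) hnn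
        (Fin.castLE hmn q) (one_le_mutExp_neg _ _ (hseed.d_pos i) hq)
      refine ⟨0, zero_mem _, ρ i 0 * F, mul_mem hρ hF, ?_⟩
      rw [h]; ring
    · obtain ⟨F, hF, h⟩ := monomial_div hmn (fun k => mutExp (d i) (B k i) r) hnn
        (Fin.castLE hmn p) (one_le_mutExp_pos _ _ _ (hseed.d_pos i) (hseed.d_dvd i p) hp h0)
      refine ⟨ρ i r * F, mul_mem hρ hF, 0, zero_mem _, ?_⟩
      rw [h]; ring

theorem prod_pow_ind {n : ℕ} {F : Type*} [Field F] (y : Fin n → F) (i : Fin n) :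
    ∏ l, y l ^ (if l = i then 1 else 0) = y i := by
  rw [Finset.prod_eq_single i]
  · simp
  · intro b _ hb; simp [hb]
  · simp

/-- Span of the standard monomials involving at most one primed variable. -/
noncomputable def lowSpan {m n : ℕ} (x y : Fin n → K m) : Submodule (↥(ZP m n)) (K m) :=
  Submodule.span _ (stdMon x y '' {v | ∑ l, (v.1 l).2 ≤ 1})

theorem polyA_mem_lowSpan {m n : ℕ} (hmn : n ≤ m) (y : Fin n → K m) {a : K m}
    (ha : a ∈ polyA hmn) : a ∈ lowSpan (fun i => xv m (Fin.castLE hmn i)) y := by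
  obtain ⟨p, rfl⟩ := ha
  induction p using MvPolynomial.induction_on' with
  | monomial e c =>
    change MvPolynomial.aeval _ _ ∈ _
    rw [MvPolynomial.aeval_monomial, ← Algebra.smul_def]
    refine Submodule.smul_mem _ _ (Submodule.subset_span ⟨⟨fun l => (e l, 0), fun l => Or.inr rfl⟩, ?_, ?_⟩)
    · change ∑ l : Fin n, 0 ≤ 1
      simp
    · simp [stdMon, Finsupp.prod_fintype]
  | add p q hp hq =>
    change MvPolynomial.aeval _ _ ∈ _
    rw [map_add]
    exact add_mem hp hq

theorem polyA_mul_mem_lowSpan {m n : ℕ} (hmn : n ≤ m) (y : Fin n → K m) (i : Fin n)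
    (hi : xv m (Fin.castLE hmn i) * y i ∈ polyA hmn) {a : K m}
    (ha : a ∈ polyA hmn) : a * y i ∈ lowSpan (fun i => xv m (Fin.castLE hmn i)) y := by
  obtain ⟨p, rfl⟩ := ha
  induction p using MvPolynomial.induction_on' with
  | monomial e c =>
    change MvPolynomial.aeval _ _ * _ ∈ _
    by_cases h : e i = 0
    · rw [MvPolynomial.aeval_monomial, mul_assoc, ← Algebra.smul_def]
      refine Submodule.smul_mem _ _ (Submodule.subset_span
        ⟨⟨fun l => (e l, if l = i then 1 else 0), fun l => ?_⟩, ?_, ?_⟩)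
      · by_cases hl : l = i
        · left; subst hl; exact h
        · right; simp [hl]
      · change ∑ l : Fin n, (if l = i then 1 else 0) ≤ 1
        simp
      · simp only [stdMon, Finset.prod_mul_distrib, prod_pow_ind]
        simp [Finsupp.prod_fintype]
    · have he : e = (e - Finsupp.single i 1) + Finsupp.single i 1 := by
        ext l
        by_cases hl : l = i
        · subst hl; simp; omega
        · simp [Finsupp.single_apply, Ne.symm hl]
      have hm : MvPolynomial.monomial e c =
          MvPolynomial.monomial (e - Finsupp.single i 1) c * MvPolynomial.X i := by
        rw [MvPolynomial.X, MvPolynomial.monomial_mul, ← he, mul_one]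
      rw [hm, map_mul, MvPolynomial.aeval_X, mul_assoc]
      exact polyA_mem_lowSpan hmn y (mul_mem ⟨_, rfl⟩ hi)
  | add p q hp hq =>
    change MvPolynomial.aeval _ _ * _ ∈ _
    rw [map_add, add_mul]
    exact add_mem hp hq

theorem three_identity {F : Type*} [Field F] (a b c A B C F1 F2 F3 G1 G2 G3 : F)
    (ha : a ≠ 0) (hb : b ≠ 0) (hc : c ≠ 0)
    (h1 : a * A = c * F1 + b * G1) (h2 : b * B = a * F2 + c * G2)
    (h3 : c * C = b * F3 + a * G3) :
    A * B * C = F1 * F2 * F3 + G1 * G2 * G3 + F1 * G3 * B + F2 * G1 * C + F3 * G2 * A := by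
  have hA : A = (c * F1 + b * G1) / a := by rw [← h1]; field_simp
  have hB : B = (a * F2 + c * G2) / b := by rw [← h2]; field_simp
  have hC : C = (b * F3 + a * G3) / c := by rw [← h3]; field_simp
  rw [hA, hB, hC]
  field_simp
  ring

end GCA

open GCA in
/-- Theorem 4.1. If the standard monomials in `x₁,x'₁,…,x_n,x'_n` of a
generalized seed of geometric type are linearly independent over `ℤℙ`, then the directed
graph `Γ(x̃,ρ,B̃)` contains no oriented 3-cycle: there are no indices `i, j, k` with
`b_{ij} > 0`, `b_{jk} > 0` and `b_{ki} > 0`. -/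
theorem no_three_cycle_of_stdMon_linearIndependent {m n : ℕ} (hn : 1 ≤ n) (hmn : n ≤ m)
    (d : Fin n → ℕ) (ρ : Fin n → ℕ → K m) (B : Matrix (Fin m) (Fin n) ℤ)
    (hseed : SeedHyps m n hmn d ρ B)
    (hlin : LinearIndependent (↥(ZP m n))
      (stdMon (fun i => xv m (Fin.castLE hmn i))
        (exchangeVar hmn d (initSeed m n ρ B)))) :
    ¬ ∃ i j k : Fin n,
        0 < B (Fin.castLE hmn i) j ∧ 0 < B (Fin.castLE hmn j) k ∧
          0 < B (Fin.castLE hmn k) i := by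
  rintro ⟨i, j, k, hij, hjk, hki⟩
  obtain ⟨D, hD, hsk⟩ := hseed.skew
  have hneg : ∀ a b : Fin n, 0 < B (Fin.castLE hmn a) b → B (Fin.castLE hmn b) a < 0 := by
    intro a b h
    have h1 := hsk a b
    have h2 := mul_pos (hD a) h
    by_contra hc
    have h3 := mul_nonneg (hD b).le (not_lt.1 hc)
    linarith
  set y := exchangeVar hmn d (initSeed m n ρ B) with hy
  obtain ⟨F1, hF1, G1, hG1, e1⟩ := exchange_split hmn d ρ B hseed i k j hki (hneg _ _ hij)
  obtain ⟨F2, hF2, G2, hG2, e2⟩ := exchange_split hmn d ρ B hseed j i k hij (hneg _ _ hjk)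
  obtain ⟨F3, hF3, G3, hG3, e3⟩ := exchange_split hmn d ρ B hseed k j i hjk (hneg _ _ hki)
  rw [← hy] at e1 e2 e3
  have key := three_identity _ _ _ _ _ _ F1 F2 F3 G1 G2 G3 (xv_ne_zero m _) (xv_ne_zero m _)
    (xv_ne_zero m _) e1 e2 e3
  have hX := fun l : Fin n => xv_mem_polyA hmn (Fin.castLE hmn l)
  have m1 : xv m (Fin.castLE hmn i) * y i ∈ polyA hmn := by
    rw [e1]; exact add_mem (mul_mem (hX _) hF1) (mul_mem (hX _) hG1)
  have m2 : xv m (Fin.castLE hmn j) * y j ∈ polyA hmn := by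
    rw [e2]; exact add_mem (mul_mem (hX _) hF2) (mul_mem (hX _) hG2)
  have m3 : xv m (Fin.castLE hmn k) * y k ∈ polyA hmn := by
    rw [e3]; exact add_mem (mul_mem (hX _) hF3) (mul_mem (hX _) hG3)
  have hmem : y i * y j * y k ∈ lowSpan (fun i => xv m (Fin.castLE hmn i)) y := by
    rw [key]
    refine add_mem (add_mem (add_mem (add_mem ?_ ?_) ?_) ?_) ?_
    · exact polyA_mem_lowSpan hmn y (mul_mem (mul_mem hF1 hF2) hF3)
    · exact polyA_mem_lowSpan hmn y (mul_mem (mul_mem hG1 hG2) hG3)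
    · exact polyA_mul_mem_lowSpan hmn y j m2 (mul_mem hF1 hG3)
    · exact polyA_mul_mem_lowSpan hmn y k m3 (mul_mem hF2 hG1)
    · exact polyA_mul_mem_lowSpan hmn y i m1 (mul_mem hF3 hG2)
  let v : StdIdx n := ⟨fun l => (0, (if l = i then 1 else 0) + (if l = j then 1 else 0) +
    (if l = k then 1 else 0)), fun l => Or.inl rfl⟩
  have hv : stdMon (fun i => xv m (Fin.castLE hmn i)) y v = y i * y j * y k := by
    simp only [stdMon, v, pow_add, Finset.prod_mul_distrib, prod_pow_ind]
    simp
  have hnot : v ∉ {v : StdIdx n | ∑ l, (v.1 l).2 ≤ 1} := by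
    change ¬ (∑ l : Fin n, ((if l = i then 1 else 0) + (if l = j then 1 else 0) +
      (if l = k then 1 else 0)) ≤ 1)
    simp only [Finset.sum_add_distrib]
    simp
  refine hlin.notMem_span_image hnot ?_
  rw [hv]
  exact hmem
end

section
/- Let B = (b_{ij}) be an n×n skew-symmetrizable integer matrix with b_{ij} ≥ 0 whenever i > j. Then for every k ∈ [1,n], the matrix B^{(k)} = μ_k μ_{k−1} ⋯ μ_1(B) has entries (B^{(k)})_{st} = b_{st} if s,t ∈ [1,k] or s,t ∈ [k+1,n], and (B^{(k)})_{st} = −b_{st} if exactly one of s,t lies in [1,k]. -/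
namespace GCA

/-- Matrix mutation of a square `n × n` integer matrix in direction `i`. -/
def matMutSq {n : ℕ} (i : Fin n) (B : Matrix (Fin n) (Fin n) ℤ) : Matrix (Fin n) (Fin n) ℤ :=
  fun k l =>
    if k = i ∨ l = i then -B k l
    else B k l + (|B k i| * B i l + B k i * |B i l|) / 2

/-- `mutUpTo B k = μ_k ⋯ μ_2 μ_1 (B)` (paper's direction `t ∈ [1,n]` is Lean's `t-1`). -/
def mutUpTo {n : ℕ} (B : Matrix (Fin n) (Fin n) ℤ) : ℕ → Matrix (Fin n) (Fin n) ℤ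
  | 0 => B
  | k + 1 => if h : k < n then matMutSq ⟨k, h⟩ (mutUpTo B k) else mutUpTo B k

/-- `B` is skew-symmetrizable: `DB` is skew-symmetric for some positive integer
diagonal matrix `D`. -/
def SkewSymmetrizableSq {n : ℕ} (B : Matrix (Fin n) (Fin n) ℤ) : Prop :=
  ∃ D : Fin n → ℤ, (∀ i, 0 < D i) ∧ ∀ i j : Fin n, D i * B i j = -(D j * B j i)

end GCA

open GCA in
/-- The statement for all `k ≤ n` (including `k = 0`), by induction on `k`. -/
theorem mutUpTo_entries_aux {n : ℕ} (B : Matrix (Fin n) (Fin n) ℤ)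
    (hskew : SkewSymmetrizableSq B)
    (hord : ∀ i j : Fin n, j < i → 0 ≤ B i j)
    (k : ℕ) (hkn : k ≤ n) : ∀ s t : Fin n,
    mutUpTo B k s t =
      if ((s : ℕ) < k ∧ (t : ℕ) < k) ∨ (k ≤ (s : ℕ) ∧ k ≤ (t : ℕ)) then B s t
      else -B s t := by
  obtain ⟨D, hD, hDB⟩ := hskew
  have hneg : ∀ i j : Fin n, i < j → B i j ≤ 0 := by
    intro i j hij
    have h1 := mul_nonneg (hD j).le (hord j i hij)
    have h2 := hDB i j
    by_contra hc
    have h3 := mul_pos (hD i) (not_le.mp hc)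
    linarith
  have hdiag : ∀ i : Fin n, B i i = 0 := by
    intro i
    have h2 := hDB i i
    have h3 : D i * B i i = 0 := by linarith
    exact (mul_eq_zero.mp h3).resolve_left (hD i).ne'
  induction k with
  | zero => intro s t; simp [mutUpTo]
  | succ k ih =>
    intro s t
    have hk : k < n := hkn
    have ih := ih hk.le
    simp only [mutUpTo, hk, dif_pos, matMutSq]
    by_cases hst : s = ⟨k, hk⟩ ∨ t = ⟨k, hk⟩
    · rw [if_pos hst, ih]
      rcases hst with rfl | rfl
      · rcases lt_trichotomy (t : ℕ) k with h | h | h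
        · rw [if_neg (by simp; omega), if_pos (by simp; omega), neg_neg]
        · have : t = ⟨k, hk⟩ := Fin.ext h
          subst this
          simp [hdiag]
        · rw [if_pos (by simp; omega), if_neg (by simp; omega)]
      · rcases lt_trichotomy (s : ℕ) k with h | h | h
        · rw [if_neg (by simp; omega), if_pos (by simp; omega), neg_neg]
        · have : s = ⟨k, hk⟩ := Fin.ext h
          subst this
          simp [hdiag]
        · rw [if_pos (by simp; omega), if_neg (by simp; omega)]
    · rw [if_neg hst]
      push Not at hst
      have hs : (s : ℕ) ≠ k := fun h => hst.1 (Fin.ext h)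
      have ht : (t : ℕ) ≠ k := fun h => hst.2 (Fin.ext h)
      have hcol : 0 ≤ mutUpTo B k s ⟨k, hk⟩ := by
        rw [ih]
        rcases lt_or_gt_of_ne hs with h | h
        · rw [if_neg (by simp; omega)]
          have := hneg s ⟨k, hk⟩ h
          linarith
        · rw [if_pos (by simp; omega)]
          exact hord s ⟨k, hk⟩ h
      have hrow : mutUpTo B k ⟨k, hk⟩ t ≤ 0 := by
        rw [ih]
        rcases lt_or_gt_of_ne ht with h | h
        · rw [if_neg (by simp; omega)]
          have := hord ⟨k, hk⟩ t h
          linarith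
        · rw [if_pos (by simp; omega)]
          exact hneg ⟨k, hk⟩ t h
      rw [abs_of_nonneg hcol, abs_of_nonpos hrow, mul_neg, add_neg_cancel, Int.zero_ediv,
        add_zero, ih]
      congr 1
      apply propext
      omega

open GCA in
/-- If `B` is an `n × n` skew-symmetrizable integer matrix with
`b_{ij} ≥ 0` whenever `i > j`, then for every `k ∈ [1,n]` the matrix
`B^{(k)} = μ_k ⋯ μ_1 (B)` has entries `b_{st}` when `s,t` both lie in `[1,k]` or both lie
in `[k+1,n]`, and `−b_{st}` when exactly one of `s,t` lies in `[1,k]`. -/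
theorem mutUpTo_entries {n : ℕ} (B : Matrix (Fin n) (Fin n) ℤ)
    (hskew : SkewSymmetrizableSq B)
    (hord : ∀ i j : Fin n, j < i → 0 ≤ B i j)
    (k : ℕ) (hk1 : 1 ≤ k) (hkn : k ≤ n) (s t : Fin n) :
    mutUpTo B k s t =
      if ((s : ℕ) < k ∧ (t : ℕ) < k) ∨ (k ≤ (s : ℕ) ∧ k ≤ (t : ℕ)) then B s t
      else -B s t := by
  exact mutUpTo_entries_aux B hskew hord k hkn s t
end

section
/- Let B = (b_{ij}) be an n×n skew-symmetrizable integer matrix with b_{ij} ≥ 0 whenever i > j. Then μ_n μ_{n−1} ⋯ μ_1(B) = B. -/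
open GCA in
/-- After mutating in the first `k` directions, an entry has changed sign exactly when
one (and only one) of its indices is below `k`. -/
lemma mutUpTo_aux {n : ℕ} (B : Matrix (Fin n) (Fin n) ℤ)
    (hdiag : ∀ i, B i i = 0)
    (hpos : ∀ i j : Fin n, j < i → 0 ≤ B i j)
    (hneg : ∀ i j : Fin n, i < j → B i j ≤ 0) (k : ℕ) (hk : k ≤ n) :
    ∀ a b : Fin n, mutUpTo B k a b =
      if (a.val < k ↔ b.val < k) then B a b else -B a b := by
  induction k with
  | zero => intro a b; simp [mutUpTo]
  | succ k ih =>
    have hkn : k < n := hk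
    have ih := ih hkn.le
    have hrow : ∀ l, mutUpTo B k ⟨k, hkn⟩ l ≤ 0 := by
      intro l
      rw [ih]
      rcases lt_trichotomy l.val k with h | h | h
      · have := hpos ⟨k, hkn⟩ l h
        simp [h, this]
      · have : l = ⟨k, hkn⟩ := Fin.ext h
        simp [this, hdiag]
      · have := hneg ⟨k, hkn⟩ l h
        simp [h.le, this]
    have hcol : ∀ l, 0 ≤ mutUpTo B k l ⟨k, hkn⟩ := by
      intro l
      rw [ih]
      rcases lt_trichotomy l.val k with h | h | h
      · have := hneg l ⟨k, hkn⟩ h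
        simp [h, this]
      · have : l = ⟨k, hkn⟩ := Fin.ext h
        simp [this, hdiag]
      · have := hpos l ⟨k, hkn⟩ h
        simp [h.le, this]
    intro a b
    have hz : |mutUpTo B k a ⟨k, hkn⟩| * mutUpTo B k ⟨k, hkn⟩ b
        + mutUpTo B k a ⟨k, hkn⟩ * |mutUpTo B k ⟨k, hkn⟩ b| = 0 := by
      rw [abs_of_nonneg (hcol a), abs_of_nonpos (hrow b)]; ring
    simp only [mutUpTo, hkn, dite_true, matMutSq]
    rw [hz, ih a b]
    have hab : a.val = k → b.val = k → B a b = 0 := by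
      intro h1 h2
      have : a = b := Fin.ext (h1.trans h2.symm)
      rw [this, hdiag]
    simp only [Fin.ext_iff]
    split_ifs <;> first | omega | (have := hab (by omega) (by omega); omega)

open GCA in
/-- If `B` is an `n × n` skew-symmetrizable integer matrix with
`b_{ij} ≥ 0` whenever `i > j`, then `μ_n μ_{n−1} ⋯ μ_1 (B) = B`. -/
theorem mutUpTo_top {n : ℕ} (B : Matrix (Fin n) (Fin n) ℤ)
    (hskew : SkewSymmetrizableSq B)
    (hord : ∀ i j : Fin n, j < i → 0 ≤ B i j) :
    mutUpTo B n = B := by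
  obtain ⟨D, hD, hs⟩ := hskew
  have hdiag : ∀ i, B i i = 0 := by
    intro i
    have h1 := hs i i
    have h2 : D i * B i i = 0 := by linarith
    exact (mul_eq_zero.mp h2).resolve_left (hD i).ne'
  have hneg : ∀ i j : Fin n, i < j → B i j ≤ 0 := by
    intro i j hij
    have h1 := hs i j
    have h2 := mul_nonneg (hD j).le (hord j i hij)
    by_contra hc
    have h3 := mul_pos (hD i) (not_le.mp hc)
    linarith
  ext a b
  rw [mutUpTo_aux B hdiag hord hneg n le_rfl a b]
  simp
end

section
/- Let B̃ = (b_{ij}) be an m×n integer matrix (m ≥ n) whose principal part is skew-symmetrizable and satisfies b_{ij} ≥ 0 whenever n ≥ i > j ≥ 1, and for each i ∈ [1,n] let d_i be a positive integer dividing b_{ji} for all j ∈ [1,n]. Fix i ∈ [1,n] and write B̃^{(i−1)} = μ_{i−1} ⋯ μ_1(B̃) with entries b^{(i−1)}_{st}. Then for every j ∈ [n+1,m]: if b^{(i−1)}_{ji} ≥ 0 then b_{ji} ≥ 0; equivalently, if b_{ji} < 0 then b^{(i−1)}_{ji} < 0. -/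
open Finset

namespace GCA

variable {m n : ℕ}

/-- `BUpTo hmn B k = μ_k ⋯ μ_2 μ_1 (B̃)` (paper's direction `t ∈ [1,n]` is Lean's `t-1`). -/
def BUpTo (hmn : n ≤ m) (B : Matrix (Fin m) (Fin n) ℤ) : ℕ → Matrix (Fin m) (Fin n) ℤ
  | 0 => B
  | k + 1 => if h : k < n then matMut hmn ⟨k, h⟩ (BUpTo hmn B k) else BUpTo hmn B k

end GCA


namespace GCA

/-- The order normalization forces `b_{tl} ≤ 0` for `t < l`. -/
theorem upper_nonpos {m n : ℕ} (hmn : n ≤ m) (B : Matrix (Fin m) (Fin n) ℤ)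
    (hskew : SkewSymmetrizable hmn B) (hord : Ordered hmn B) (t l : Fin n) (h : t < l) :
    B (Fin.castLE hmn t) l ≤ 0 := by
  obtain ⟨D, hD, hs⟩ := hskew
  have h1 := hs t l
  have h2 := mul_nonneg (hD l).le (hord l t h)
  by_contra! h3
  have h4 := mul_pos (hD t) h3
  linarith

/-- After `t` mutations the lower right principal block is unchanged, and the
frozen entries in the remaining columns have not increased. -/
theorem invariant {m n : ℕ} (hmn : n ≤ m) (B : Matrix (Fin m) (Fin n) ℤ)
    (hskew : SkewSymmetrizable hmn B) (hord : Ordered hmn B) (t : ℕ) (ht : t ≤ n) :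
    (∀ k l : Fin n, t ≤ (k : ℕ) → t ≤ (l : ℕ) →
      BUpTo hmn B t (Fin.castLE hmn k) l = B (Fin.castLE hmn k) l) ∧
    (∀ (j : Fin m) (l : Fin n), n ≤ (j : ℕ) → t ≤ (l : ℕ) → BUpTo hmn B t j l ≤ B j l) := by
  induction t with
  | zero => exact ⟨fun _ _ _ _ => rfl, fun _ _ _ _ => le_rfl⟩
  | succ t ih =>
    obtain ⟨ih1, ih2⟩ := ih (by omega)
    have htn : t < n := by omega
    constructor
    · intro k l hk hl
      have hne : ¬ (Fin.castLE hmn k = Fin.castLE hmn ⟨t, htn⟩ ∨ l = ⟨t, htn⟩) := by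
        simp only [Fin.ext_iff, Fin.val_castLE]
        omega
      simp only [BUpTo, dif_pos htn, matMut, if_neg hne]
      rw [ih1 k l (by omega) (by omega), ih1 k ⟨t, htn⟩ (by omega) le_rfl,
        ih1 ⟨t, htn⟩ l le_rfl (by omega)]
      rw [abs_of_nonneg (hord k ⟨t, htn⟩ (by rw [Fin.lt_def]; exact hk)),
        abs_of_nonpos (upper_nonpos hmn B hskew hord ⟨t, htn⟩ l (by rw [Fin.lt_def]; exact hl))]
      simp
    · intro j l hj hl
      have hne : ¬ (j = Fin.castLE hmn ⟨t, htn⟩ ∨ l = ⟨t, htn⟩) := by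
        simp only [Fin.ext_iff, Fin.val_castLE]
        omega
      simp only [BUpTo, dif_pos htn, matMut, if_neg hne]
      have h0 := ih2 j l hj (by omega)
      rw [ih1 ⟨t, htn⟩ l le_rfl (by omega)]
      have hu := upper_nonpos hmn B hskew hord ⟨t, htn⟩ l (by rw [Fin.lt_def]; exact hl)
      rw [abs_of_nonpos hu]
      have h2 := mul_nonneg (sub_nonneg.2 (le_abs_self (BUpTo hmn B t j ⟨t, htn⟩)))
        (neg_nonneg.2 hu)
      generalize hx : |BUpTo hmn B t j ⟨t, htn⟩| * B (Fin.castLE hmn ⟨t, htn⟩) l +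
        BUpTo hmn B t j ⟨t, htn⟩ * -B (Fin.castLE hmn ⟨t, htn⟩) l = x
      have h3 : x ≤ 0 := by linarith
      omega

end GCA

open GCA in
/-- For a skew-symmetrizable ordered `m × n` exchange matrix with
divisibility data `d`, a mutable index `i` and a frozen index `j`: if
`b^{(i−1)}_{ji} ≥ 0` then `b_{ji} ≥ 0`, where `B̃^{(i−1)} = μ_{i−1} ⋯ μ_1(B̃)`. -/
theorem sign_of_mutated_frozen_entry {m n : ℕ} (hn : 1 ≤ n) (hmn : n ≤ m)
    (B : Matrix (Fin m) (Fin n) ℤ) (d : Fin n → ℕ)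
    (hskew : SkewSymmetrizable hmn B) (hord : Ordered hmn B)
    (hd : ∀ i, 0 < d i)
    (hdvd : ∀ i j : Fin n, (d i : ℤ) ∣ B (Fin.castLE hmn j) i)
    (i : Fin n) (j : Fin m) (hj : n ≤ (j : ℕ))
    (hpos : 0 ≤ BUpTo hmn B (i : ℕ) j i) :
    0 ≤ B j i := by
  exact hpos.trans ((invariant hmn B hskew hord i i.isLt.le).2 j i hj le_rfl)
end

section
/- Let Σ = (x̃,ρ,B̃) be an acyclic generalized seed ordered so that b_{ij} ≥ 0 whenever n ≥ i > j ≥ 1, and fix i ∈ [1,n]. If b_{ki} = 0 for all k ∈ [1,i−1], then x_i^{(i)} = x'_i, where x_i^{(i)} is the i-th cluster variable of Σ^{(i)} = μ_i ⋯ μ_1(Σ) and x'_i is the cluster variable obtained by mutating the initial seed Σ once in direction i. -/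
open Finset

namespace GCA

theorem mutExp_zero (d r : ℕ) : mutExp d 0 r = 0 := by
  simp [mutExp]

/-- Invariants of the first `i` mutations when the top of column `i` vanishes. -/
theorem seedUpTo_inv {m n : ℕ} (hmn : n ≤ m) (d : Fin n → ℕ) (S : Seed m n) (i : Fin n)
    (hzero : ∀ k : Fin n, k < i → S.B (Fin.castLE hmn k) i = 0) (k : ℕ) (hk : k ≤ (i : ℕ)) :
    (∀ j : Fin m, k ≤ (j : ℕ) → (seedUpTo hmn d S k).x j = S.x j) ∧
    (∀ r, (seedUpTo hmn d S k).ρ i r = S.ρ i r) ∧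
    (∀ j, (seedUpTo hmn d S k).B j i = S.B j i) := by
  induction k with
  | zero => exact ⟨fun _ _ => rfl, fun _ => rfl, fun _ => rfl⟩
  | succ k ih =>
    obtain ⟨h1, h2, h3⟩ := ih (by omega)
    have hkn : k < n := by omega
    have hne : i ≠ (⟨k, hkn⟩ : Fin n) := by
      intro h
      have := congrArg Fin.val h
      simp at this
      omega
    have hz : S.B (Fin.castLE hmn ⟨k, hkn⟩) i = 0 := hzero ⟨k, hkn⟩ (Fin.lt_def.2 (by simp; omega))
    simp only [seedUpTo, dif_pos hkn, Seed.mut]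
    refine ⟨fun j hj => ?_, fun r => ?_, fun j => ?_⟩
    · rw [if_neg, h1 j (by omega)]
      intro h
      have := congrArg Fin.val h
      simp at this
      omega
    · rw [if_neg hne, h2]
    · unfold matMut
      split_ifs with h
      · rcases h with h | h
        · subst h
          rw [h3, hz, neg_zero]
        · exact absurd h hne
      · rw [h3, h3, hz]
        simp

end GCA

open GCA in
/-- For an acyclic generalized seed ordered so that `b_{ij} ≥ 0` whenever
`i > j`, if `b_{ki} = 0` for all `k ∈ [1,i−1]`, then the `i`-th cluster variable of
`Σ^{(i)} = μ_i ⋯ μ_1(Σ)` equals `x'_i`, the cluster variable obtained by mutating the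
initial seed once in direction `i`. -/
theorem projStep_eq_exchange_of_zero_column {m n : ℕ} (hn : 1 ≤ n) (hmn : n ≤ m)
    (d : Fin n → ℕ) (ρ : Fin n → ℕ → K m) (B : Matrix (Fin m) (Fin n) ℤ)
    (hseed : SeedHyps m n hmn d ρ B)
    (hacyc : Acyclic hmn B) (hord : Ordered hmn B) (i : Fin n)
    (hzero : ∀ k : Fin n, k < i → B (Fin.castLE hmn k) i = 0) :
    (seedUpTo hmn d (initSeed m n ρ B) ((i : ℕ) + 1)).x (Fin.castLE hmn i) =
      exchangeVar hmn d (initSeed m n ρ B) i := by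
  have hz : ∀ k : Fin n, k < i → (initSeed m n ρ B).B (Fin.castLE hmn k) i = 0 := hzero
  obtain ⟨h1, h2, h3⟩ := seedUpTo_inv hmn d (initSeed m n ρ B) i hz i le_rfl
  generalize initSeed m n ρ B = S at *
  simp only [seedUpTo, dif_pos i.isLt, Seed.mut, if_true]
  unfold exchangeVar
  rw [h1 _ (by simp)]
  congr 1
  refine Finset.sum_congr rfl fun r _ => ?_
  rw [h2]
  congr 1
  refine Finset.prod_congr rfl fun j _ => ?_
  rw [h3]
  by_cases hj : (i : ℕ) ≤ (j : ℕ)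
  · rw [h1 j hj]
  · have hjn : (j : ℕ) < n := by omega
    have : S.B j i = 0 := hz ⟨j, hjn⟩ (Fin.lt_def.2 (by simp; omega))
    rw [this, mutExp_zero, zpow_zero, zpow_zero]
end

section
/- Let Σ = (x̃,ρ,B̃) be an acyclic generalized seed ordered so that b_{ij} ≥ 0 whenever n ≥ i > j ≥ 1. For each k ∈ [1,n], writing B̃^{(k−1)} = μ_{k−1}⋯μ_1(B̃) with entries b^{(k−1)}_{st} and β^{(k−1)}_{jk} = b^{(k−1)}_{jk}/d_k, the k-th cluster variable of Σ^{(k)} = μ_k⋯μ_1(Σ) satisfies x_k^{(k)} = x_k^{-1} ( A^{(k)} + ∏_{j ∈ [n+1,m], b^{(k−1)}_{jk} < 0} x_j^{−b^{(k−1)}_{jk}} ), where A^{(k)} = Σ_{r=1}^{d_k} ρ_{k,r} ∏_{j=k}^{n} x_j^{rβ_{jk}} ∏_{j=1}^{k−1} (x_j^{(j)})^{−rβ_{jk}} ∏_{j ∈ [n+1,m], b^{(k−1)}_{jk} ≥ 0} x_j^{⌊[rβ^{(k−1)}_{jk}]_+⌋} ∏_{j ∈ [n+1,m], b^{(k−1)}_{jk}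 < 0} x_j^{⌊[(d_k−r)(−β^{(k−1)}_{jk})]_+⌋}. -/
open Finset

namespace GCA

theorem seedUpTo_x_ge {m n : ℕ} (hmn : n ≤ m) (d : Fin n → ℕ) (S : Seed m n) (j : Fin m) (t : ℕ)
    (h : t ≤ (j : ℕ) ∨ n ≤ (j : ℕ)) : (seedUpTo hmn d S t).x j = S.x j := by
  induction t with
  | zero => rfl
  | succ t ih =>
    have ih := ih (by omega)
    rw [seedUpTo]
    split_ifs with ht
    · have hne : j ≠ Fin.castLE hmn ⟨t, ht⟩ := by
        intro e
        have := congrArg Fin.val e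
        simp at this
        omega
      simp only [Seed.mut, hne, if_false, ih]
    · exact ih

theorem seedUpTo_x_lt {m n : ℕ} (hmn : n ≤ m) (d : Fin n → ℕ) (S : Seed m n) (j : Fin n) (t : ℕ)
    (h : (j : ℕ) + 1 ≤ t) : (seedUpTo hmn d S t).x (Fin.castLE hmn j) =
      (seedUpTo hmn d S ((j : ℕ) + 1)).x (Fin.castLE hmn j) := by
  induction t, h using Nat.le_induction with
  | base => rfl
  | succ t h ih =>
    rw [seedUpTo]
    split_ifs with ht
    · have hne : Fin.castLE hmn j ≠ Fin.castLE hmn ⟨t, ht⟩ := by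
        intro e
        have := congrArg Fin.val e
        simp at this
        omega
      simp only [Seed.mut, hne, if_false, ih]
    · exact ih

theorem seedUpTo_rho {m n : ℕ} (hmn : n ≤ m) (d : Fin n → ℕ) (S : Seed m n) (j : Fin n) (t : ℕ)
    (h : t ≤ (j : ℕ)) : (seedUpTo hmn d S t).ρ j = S.ρ j := by
  induction t with
  | zero => rfl
  | succ t ih =>
    have ih := ih (by omega)
    rw [seedUpTo]
    split_ifs with ht
    · have hne : j ≠ ⟨t, ht⟩ := by
        intro e
        have := congrArg Fin.val e
        simp at this
        omega
      funext r
      simp [Seed.mut, hne, ih]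
    · exact ih

/-- Skew-symmetrizability turns the ordering condition into a sign condition above the diagonal. -/
theorem nonpos_of_le {m n : ℕ} {hmn : n ≤ m} {B : Matrix (Fin m) (Fin n) ℤ}
    (hs : SkewSymmetrizable hmn B) (ho : Ordered hmn B) (i j : Fin n) (h : i ≤ j) :
    B (Fin.castLE hmn i) j ≤ 0 := by
  obtain ⟨D, hD, hB⟩ := hs
  have e := hB i j
  have h1 := hD i
  have h2 := hD j
  rcases h.eq_or_lt with rfl | hlt
  · nlinarith
  · have h3 := mul_nonneg h2.le (ho j i hlt)
    by_contra hc
    push Not at hc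
    have := mul_pos h1 hc
    omega

theorem nonneg_of_le {m n : ℕ} {hmn : n ≤ m} {B : Matrix (Fin m) (Fin n) ℤ}
    (hs : SkewSymmetrizable hmn B) (ho : Ordered hmn B) (i j : Fin n) (h : j ≤ i) :
    0 ≤ B (Fin.castLE hmn i) j := by
  rcases h.eq_or_lt with rfl | hlt
  · obtain ⟨D, hD, hB⟩ := hs
    have e := hB j j
    have h1 := hD j
    nlinarith
  · exact ho i j hlt

theorem seedUpTo_B {m n : ℕ} (hmn : n ≤ m) (d : Fin n → ℕ) (S : Seed m n)
    (hs : SkewSymmetrizable hmn S.B) (ho : Ordered hmn S.B) (t : ℕ) (ht : t ≤ n) (i j : Fin n) :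
    (seedUpTo hmn d S t).B (Fin.castLE hmn i) j =
      (if (i : ℕ) < t then -1 else 1) * (if (j : ℕ) < t then -1 else 1) *
        S.B (Fin.castLE hmn i) j := by
  induction t generalizing i j with
  | zero => simp [seedUpTo]
  | succ t ih =>
    have ih := ih (by omega)
    have ht' : t < n := by omega
    rw [seedUpTo, dif_pos ht']
    have hcast : ∀ a : Fin n, (Fin.castLE hmn a = Fin.castLE hmn ⟨t, ht'⟩) ↔ (a : ℕ) = t := by
      intro a; simp [Fin.ext_iff]
    have heq : ∀ a : Fin n, (a = (⟨t, ht'⟩ : Fin n)) ↔ (a : ℕ) = t := by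
      intro a; simp [Fin.ext_iff]
    simp only [Seed.mut, matMut, hcast, heq, ih]
    have hdiag : S.B (Fin.castLE hmn ⟨t, ht'⟩) ⟨t, ht'⟩ = 0 :=
      le_antisymm (nonpos_of_le hs ho _ _ le_rfl) (nonneg_of_le hs ho _ _ le_rfl)
    by_cases hi : (i : ℕ) = t
    · obtain rfl : i = ⟨t, ht'⟩ := (heq i).2 hi
      by_cases hj : (j : ℕ) = t
      · obtain rfl : j = ⟨t, ht'⟩ := (heq j).2 hj
        simp [hdiag, -Fin.castLE_mk]
      · have : ((j : ℕ) < t + 1) ↔ (j : ℕ) < t := by omega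
        simp only [this]
        by_cases h : (j : ℕ) < t <;> simp [h, -Fin.castLE_mk]
    · have hi' : ((i : ℕ) < t + 1) ↔ (i : ℕ) < t := by omega
      by_cases hj : (j : ℕ) = t
      · obtain rfl : j = ⟨t, ht'⟩ := (heq j).2 hj
        simp [hi']
      · have hj' : ((j : ℕ) < t + 1) ↔ (j : ℕ) < t := by omega
        have c1 : 0 ≤ (if (i : ℕ) < t then (-1 : ℤ) else 1) * (if t < t then -1 else 1) *
            S.B (Fin.castLE hmn i) ⟨t, ht'⟩ := by
          by_cases h : (i : ℕ) < t
          · have := nonpos_of_le hs ho i ⟨t, ht'⟩ (by simp [Fin.le_def]; omega)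
            simp [h, -Fin.castLE_mk]; omega
          · have := nonneg_of_le hs ho i ⟨t, ht'⟩ (by simp [Fin.le_def]; omega)
            simp [h, -Fin.castLE_mk]; omega
        have c2 : (if t < t then (-1 : ℤ) else 1) * (if (j : ℕ) < t then -1 else 1) *
            S.B (Fin.castLE hmn ⟨t, ht'⟩) j ≤ 0 := by
          by_cases h : (j : ℕ) < t
          · have := nonneg_of_le hs ho ⟨t, ht'⟩ j (by simp [Fin.le_def]; omega)
            simp [h, -Fin.castLE_mk]; omega
          · have := nonpos_of_le hs ho ⟨t, ht'⟩ j (by simp [Fin.le_def]; omega)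
            simp [h, -Fin.castLE_mk]; omega
        rw [if_neg (by tauto), abs_of_nonneg c1, abs_of_nonpos c2]
        simp only [hi', hj']
        simp

theorem mutExp_nonneg_s11 (d : ℕ) (b : ℤ) (r : ℕ) (hb : 0 ≤ b) (hr : r ≤ d) :
    mutExp d b r = ⌊max ((r : ℚ) * b / d) 0⌋ := by
  have h1 : (0 : ℚ) ≤ b := by exact_mod_cast hb
  have h2 : (0 : ℚ) ≤ (d : ℚ) - r := by
    have : (r : ℚ) ≤ d := by exact_mod_cast hr
    linarith
  have : 0 ≤ ((d : ℚ) - r) * b / d := by positivity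
  unfold mutExp
  rw [max_eq_right (a := -(((d : ℚ) - r) * b / d)) (by linarith)]
  simp

theorem mutExp_neg (d : ℕ) (b : ℤ) (r : ℕ) (hb : b < 0) :
    mutExp d b r = ⌊max (((d : ℚ) - (r : ℚ)) * (-(b : ℚ)) / (d : ℚ)) 0⌋ := by
  have h1 : (0 : ℚ) ≤ -b := by
    have : (b : ℚ) < 0 := by exact_mod_cast hb
    linarith
  have : 0 ≤ (r : ℚ) * (-b) / d := by positivity
  unfold mutExp
  rw [max_eq_right (a := (r : ℚ) * b / d) (by
    have e : (r : ℚ) * b / d = -((r : ℚ) * (-b) / d) := by ring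
    linarith)]
  simp only [Int.floor_zero, zero_add]
  congr 2
  ring

theorem mutExp_dvd (d : ℕ) (c : ℤ) (r : ℕ) (hd : 0 < d) (hb : 0 ≤ (d : ℤ) * c) (hr : r ≤ d) :
    mutExp d ((d : ℤ) * c) r = r * c := by
  rw [mutExp_nonneg_s11 _ _ _ hb hr]
  have hd' : (d : ℚ) ≠ 0 := by positivity
  have hc : 0 ≤ c := nonneg_of_mul_nonneg_right hb (by exact_mod_cast hd)
  have e : (r : ℚ) * (((d : ℤ) * c : ℤ) : ℚ) / d = ((r * c : ℤ) : ℚ) := by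
    push_cast
    field_simp
  rw [e, max_eq_left (by exact_mod_cast (by positivity : (0 : ℤ) ≤ r * c)), Int.floor_intCast]

theorem prod_split {m n : ℕ} (hmn : n ≤ m) {M : Type*} [CommMonoid M] (f : Fin m → M)
    (k : Fin n) (p : Fin m → Prop) [DecidablePred p] (q : Fin m → Prop) [DecidablePred q]
    (hq : ∀ j, q j ↔ ¬ p j) :
    ∏ j, f j = (∏ j ∈ univ.filter (fun j : Fin n => k ≤ j), f (Fin.castLE hmn j)) *
      (∏ j ∈ univ.filter (fun j : Fin n => j < k), f (Fin.castLE hmn j)) *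
      (∏ j ∈ univ.filter (fun j : Fin m => n ≤ (j : ℕ) ∧ p j), f j) *
      (∏ j ∈ univ.filter (fun j : Fin m => n ≤ (j : ℕ) ∧ q j), f j) := by
  rw [mul_assoc]
  have e1 : (∏ j ∈ univ.filter (fun j : Fin n => k ≤ j), f (Fin.castLE hmn j)) *
      (∏ j ∈ univ.filter (fun j : Fin n => j < k), f (Fin.castLE hmn j)) =
      ∏ j : Fin n, f (Fin.castLE hmn j) := by
    rw [← Finset.prod_filter_mul_prod_filter_not univ (fun j : Fin n => k ≤ j)]
    simp only [not_le]
  have e2 : (∏ j ∈ univ.filter (fun j : Fin m => n ≤ (j : ℕ) ∧ p j), f j) *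
      (∏ j ∈ univ.filter (fun j : Fin m => n ≤ (j : ℕ) ∧ q j), f j) =
      ∏ j ∈ univ.filter (fun j : Fin m => n ≤ (j : ℕ)), f j := by
    rw [← Finset.prod_filter_mul_prod_filter_not (univ.filter (fun j : Fin m => n ≤ (j : ℕ))) p]
    simp only [Finset.filter_filter, hq]
  rw [e1, e2, ← Finset.prod_filter_mul_prod_filter_not univ (fun j : Fin m => n ≤ (j : ℕ)),
    mul_comm]
  congr 1
  symm
  refine Finset.prod_bij (fun j _ => Fin.castLE hmn j) ?_ ?_ ?_ ?_
  · intro a _; simp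
  · intro a _ b _ h; simpa using h
  · intro b hb
    simp at hb
    exact ⟨⟨b, hb⟩, by simp, by ext; simp⟩
  · intros; rfl

end GCA

open GCA in
/-- Equations (3.2)/(3.3). For an acyclic generalized seed ordered so
that `b_{ij} ≥ 0` whenever `i > j`, the `k`-th cluster variable of `Σ^{(k)} = μ_k ⋯ μ_1(Σ)`
satisfies `x_k^{(k)} = x_k^{-1} (A^{(k)} + ∏_{j frozen, b^{(k−1)}_{jk}<0} x_j^{−b^{(k−1)}_{jk}})`
with `A^{(k)}` as in the paper. -/
theorem projStep_formula {m n : ℕ} (hn : 1 ≤ n) (hmn : n ≤ m)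
    (d : Fin n → ℕ) (ρ : Fin n → ℕ → K m) (B : Matrix (Fin m) (Fin n) ℤ)
    (hseed : SeedHyps m n hmn d ρ B)
    (hacyc : Acyclic hmn B) (hord : Ordered hmn B) (k : Fin n) :
    (seedUpTo hmn d (initSeed m n ρ B) ((k : ℕ) + 1)).x (Fin.castLE hmn k) =
      (xv m (Fin.castLE hmn k))⁻¹ *
        ((∑ r ∈ Finset.Icc 1 (d k),
            ρ k r *
              (∏ j ∈ Finset.univ.filter (fun j : Fin n => k ≤ j),
                xv m (Fin.castLE hmn j) ^
                  ((r : ℤ) * (B (Fin.castLE hmn j) k / (d k : ℤ)))) *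
              (∏ j ∈ Finset.univ.filter (fun j : Fin n => j < k),
                ((seedUpTo hmn d (initSeed m n ρ B) ((j : ℕ) + 1)).x (Fin.castLE hmn j)) ^
                  (-((r : ℤ) * (B (Fin.castLE hmn j) k / (d k : ℤ))))) *
              (∏ j ∈ Finset.univ.filter (fun j : Fin m =>
                  n ≤ (j : ℕ) ∧ 0 ≤ (seedUpTo hmn d (initSeed m n ρ B) (k : ℕ)).B j k),
                xv m j ^
                  ⌊max ((r : ℚ) *
                    ((seedUpTo hmn d (initSeed m n ρ B) (k : ℕ)).B j k : ℚ) / (d k : ℚ)) 0⌋) *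
              (∏ j ∈ Finset.univ.filter (fun j : Fin m =>
                  n ≤ (j : ℕ) ∧ (seedUpTo hmn d (initSeed m n ρ B) (k : ℕ)).B j k < 0),
                xv m j ^
                  ⌊max (((d k : ℚ) - (r : ℚ)) *
                    (-((seedUpTo hmn d (initSeed m n ρ B) (k : ℕ)).B j k : ℚ)) / (d k : ℚ)) 0⌋)) +
          ∏ j ∈ Finset.univ.filter (fun j : Fin m =>
              n ≤ (j : ℕ) ∧ (seedUpTo hmn d (initSeed m n ρ B) (k : ℕ)).B j k < 0),
            xv m j ^ (-(seedUpTo hmn d (initSeed m n ρ B) (k : ℕ)).B j k)) := by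
  set T := seedUpTo hmn d (initSeed m n ρ B) (k : ℕ) with hT
  have hx : ∀ j : Fin m, ((k : ℕ) ≤ j ∨ n ≤ (j : ℕ)) → T.x j = xv m j := fun j h =>
    seedUpTo_x_ge hmn d _ j _ h
  have hx' : ∀ j : Fin n, j < k → T.x (Fin.castLE hmn j) =
      (seedUpTo hmn d (initSeed m n ρ B) ((j : ℕ) + 1)).x (Fin.castLE hmn j) := fun j h =>
    seedUpTo_x_lt hmn d _ j _ h
  have hρ : T.ρ k = ρ k := seedUpTo_rho hmn d _ k _ le_rfl
  have hB := seedUpTo_B hmn d (initSeed m n ρ B) hseed.skew hord (k : ℕ) k.2.le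
  rw [← hT] at hB
  change ∀ i j : Fin n, _ = _ * B _ _ at hB
  have hdpos := hseed.d_pos k
  -- exponents of the mutable variables
  have hge : ∀ j : Fin n, k ≤ j → ∀ r, r ≤ d k →
      mutExp (d k) (T.B (Fin.castLE hmn j) k) r =
        (r : ℤ) * (B (Fin.castLE hmn j) k / (d k : ℤ)) := by
    intro j hj r hr
    obtain ⟨c, hc⟩ := hseed.d_dvd k j
    have h0 := nonneg_of_le hseed.skew hord j k hj
    have e : T.B (Fin.castLE hmn j) k = (d k : ℤ) * c := by
      rw [hB, ← hc, if_neg (not_lt.2 (Fin.le_def.1 hj)), if_neg (by simp)]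
      ring
    rw [e, mutExp_dvd _ _ _ hdpos (hc ▸ h0) hr, hc, Int.mul_ediv_cancel_left _ (by omega)]
  have hlt : ∀ j : Fin n, j < k → ∀ r, r ≤ d k →
      mutExp (d k) (T.B (Fin.castLE hmn j) k) r =
        -((r : ℤ) * (B (Fin.castLE hmn j) k / (d k : ℤ))) := by
    intro j hj r hr
    obtain ⟨c, hc⟩ := hseed.d_dvd k j
    have h0 := nonpos_of_le hseed.skew hord j k hj.le
    have e : T.B (Fin.castLE hmn j) k = (d k : ℤ) * (-c) := by
      rw [hB, hc, if_pos (Fin.lt_def.1 hj), if_neg (by simp)]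
      ring
    rw [e, mutExp_dvd _ _ _ hdpos (by rw [mul_neg, ← hc]; omega) hr, hc,
      Int.mul_ediv_cancel_left _ (by omega)]
    ring
  -- the monomial attached to each index
  have key : ∀ r, r ≤ d k → ∏ j : Fin m, T.x j ^ mutExp (d k) (T.B j k) r =
      (∏ j ∈ Finset.univ.filter (fun j : Fin n => k ≤ j),
        xv m (Fin.castLE hmn j) ^ ((r : ℤ) * (B (Fin.castLE hmn j) k / (d k : ℤ)))) *
      (∏ j ∈ Finset.univ.filter (fun j : Fin n => j < k),
        ((seedUpTo hmn d (initSeed m n ρ B) ((j : ℕ) + 1)).x (Fin.castLE hmn j)) ^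
          (-((r : ℤ) * (B (Fin.castLE hmn j) k / (d k : ℤ))))) *
      (∏ j ∈ Finset.univ.filter (fun j : Fin m => n ≤ (j : ℕ) ∧ 0 ≤ T.B j k),
        xv m j ^ ⌊max ((r : ℚ) * (T.B j k : ℚ) / (d k : ℚ)) 0⌋) *
      (∏ j ∈ Finset.univ.filter (fun j : Fin m => n ≤ (j : ℕ) ∧ T.B j k < 0),
        xv m j ^ ⌊max (((d k : ℚ) - (r : ℚ)) * (-(T.B j k : ℚ)) / (d k : ℚ)) 0⌋) := by
    intro r hr
    rw [prod_split hmn _ k (fun j => 0 ≤ T.B j k) (fun j => T.B j k < 0)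
      (fun j => not_le.symm)]
    congr 1
    · congr 1
      · congr 1
        · refine Finset.prod_congr rfl fun j hj => ?_
          have hj := (Finset.mem_filter.1 hj).2
          rw [hge j hj r hr, hx _ (Or.inl (Fin.le_def.1 hj))]
        · refine Finset.prod_congr rfl fun j hj => ?_
          have hj := (Finset.mem_filter.1 hj).2
          rw [hlt j hj r hr, hx' _ hj]
      · refine Finset.prod_congr rfl fun j hj => ?_
        have hj := (Finset.mem_filter.1 hj).2
        rw [mutExp_nonneg_s11 _ _ _ hj.2 hr, hx _ (Or.inr hj.1)]
    · refine Finset.prod_congr rfl fun j hj => ?_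
      have hj := (Finset.mem_filter.1 hj).2
      rw [mutExp_neg _ _ _ hj.2, hx _ (Or.inr hj.1)]
  have hstep : (seedUpTo hmn d (initSeed m n ρ B) ((k : ℕ) + 1)).x (Fin.castLE hmn k) =
      exchangeVar hmn d T k := by
    rw [seedUpTo, dif_pos k.2]
    simp [Seed.mut, hT]
  rw [hstep, exchangeVar, hx _ (Or.inl (by simp)), hρ]
  congr 1
  rw [Finset.range_eq_Ico, Finset.sum_eq_sum_Ico_succ_bot (by omega), add_comm]
  have hIcc : Finset.Ico (0 + 1) (d k + 1) = Finset.Icc 1 (d k) := by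
    ext; simp
  rw [hIcc]
  congr 1
  · refine Finset.sum_congr rfl fun r hr => ?_
    rw [key r (Finset.mem_Icc.1 hr).2]
    ring
  · rw [key 0 (Nat.zero_le _), hseed.rho_zero]
    have hd0 : (d k : ℚ) ≠ 0 := by positivity
    simp only [Nat.cast_zero, zero_mul, neg_zero, zpow_zero, Finset.prod_const_one, one_mul,
      zero_div, max_self, Int.floor_zero, sub_zero]
    refine Finset.prod_congr rfl fun j hj => ?_
    have hj := (Finset.mem_filter.1 hj).2
    have e : (d k : ℚ) * (-(T.B j k : ℚ)) / (d k : ℚ) = ((-(T.B j k) : ℤ) : ℚ) := by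
      push_cast
      field_simp
    rw [e, max_eq_left (by exact_mod_cast (by omega : (0 : ℤ) ≤ -(T.B j k))), Int.floor_intCast]
end
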